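/- Let p_1 < p_2 be distinct primes, q = p_1·p_2, m_1, m_2 ≥ 2, m = m_1 + m_2, L = p_1^{m_1}·p_2^{m_2}. With arbitrary functions f_i, f'_i, h_j, h'_j, f_0, h_0, g_α, g'_β : ℤ_q → ℤ_q, constant γ ∈ ℤ_q, permutations π of {1,…,m_1} and π' of {m_1+1,…,m}, define f(x_1,…,x_m) = (q/p_1)·∑_{i=1}^{m_1−1} f_i(x_{π(i)}) f'_i(x_{π(i+1)}) + ∑_{α=1}^{m_1} g_α(x_α) + (q/p_2)·∑_{j=1}^{m_2−1} h_j(x_{π'(m_1+j)}) h'_j(x_{π'(m_1+j+1)}) + ∑_{β=1}^{m_2} g'_β(x_{β+m_1}) + γ·f_0(x_{π(m_1)})·h_0(x_{π'(m_1+1)}), and for t = p_1·t_2 + t_1 (t_1 ∈ {0,…,p_1−1}, t_2 ∈ {0,…,p_2−1}) let ψ(C_t) be the code whose sequences, indexed by (d_1,d_2) ∈ {0,…,p_1−1}×{0,…,p_2−1}, have x-th entry ξ_q^{f(x_1,…,x_m) + (q/p_1)(d_1·x_{π(1)} + t_1·x_{π(m_1)}) + (q/p_2)(d_2·x_{π'(m_1+1)}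 + t_2·x_{π'(m)})}. Then for all t, t' ∈ {0,…,p_1p_2−1}: Θ(ψ(C_t), ψ(C_{t'}))(0) = p_1^{m_1+1}·p_2^{m_2+1} if t = t', and Θ(ψ(C_t), ψ(C_{t'}))(0) = 0 if t ≠ t'. -/

import Mathlib

open scoped Classical

/-- Aperiodic cross-correlation function (ACCF) of two length-`L` complex sequences
at integer shift `τ`:
`Θ(a,b)(τ) = ∑_{t=0}^{L−τ−1} a_t · conj(b_{t+τ})` for `0 ≤ τ`, and
`Θ(a,b)(τ) = ∑_{t=0}^{L+τ−1} a_{t−τ} · conj(b_t)` for `τ < 0`. -/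
noncomputable def accf (L : ℕ) (a b : ℕ → ℂ) (τ : ℤ) : ℂ :=
  if 0 ≤ τ then
    ∑ t ∈ Finset.range (L - τ.toNat), a t * (starRingEnd ℂ) (b (t + τ.toNat))
  else
    ∑ t ∈ Finset.range (L - (-τ).toNat), a (t + (-τ).toNat) * (starRingEnd ℂ) (b t)

/-- ACCF (sum) of two codes, i.e. tuples of length-`L` sequences indexed by `κ`:
`Θ(C, C')(τ) = ∑_m Θ(c^m, c'^m)(τ)`. -/
noncomputable def codeACCF {κ : Type*} [Fintype κ] (L : ℕ) (C C' : κ → ℕ → ℂ)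
    (τ : ℤ) : ℂ :=
  ∑ m : κ, accf L (C m) (C' m) τ

/-- A family of codes `C_k` (`k : ι`), each a (`card κ`)-tuple of length-`L` sequences,
is a set of complete complementary codes (CCC) if the number of sequences per code equals
the number `K` of codes, `Θ(C_{k₁}, C_{k₂})(0) = K·L`, and all other aperiodic
auto/cross-correlation sums with `|τ| < L` vanish. -/
noncomputable def IsCCC {ι κ : Type*} [Fintype ι] [Fintype κ] (L : ℕ)
    (C : ι → κ → ℕ → ℂ) : Prop :=
  Fintype.card κ = Fintype.card ι ∧
  ∀ k₁ k₂ : ι, ∀ τ : ℤ, |τ| < (L : ℤ) →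
    codeACCF L (C k₁) (C k₂) τ =
      if τ = 0 ∧ k₁ = k₂ then ((Fintype.card ι : ℂ) * (L : ℂ)) else 0

/-- `ξ_q = exp(2πi/q)`, a primitive `q`-th root of unity. -/
noncomputable def xi (q : ℕ) : ℂ := Complex.exp (2 * Real.pi * Complex.I / q)

/-- Mixed-radix digits of `x ∈ {0,…,p₁^{m₁}p₂^{m₂}−1}` (with `x = σ₁ + σ₂·p₁^{m₁}`):
for a 0-based position `j`, the digit is the `(j+1)`-st base-`p₁` digit of `σ₁` if
`j < m₁`, and the `(j−m₁+1)`-st base-`p₂` digit of `σ₂` otherwise. -/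
def mdig (p₁ p₂ m₁ x j : ℕ) : ℕ :=
  if j < m₁ then x % p₁ ^ m₁ / p₁ ^ j % p₁
  else x / p₁ ^ m₁ / p₂ ^ (j - m₁) % p₂

/-- Mixed-radix digit regarded as an element of `ℤ_q`. -/
def mdigZ (q p₁ p₂ m₁ x j : ℕ) : ZMod q := ((mdig p₁ p₂ m₁ x j : ℕ) : ZMod q)

/-- `φ : ℤ_q → ℤ_q` permutes `{0,…,p−1}` under reduction modulo `p`: the map sending
`u ∈ {0,…,p−1}` to `φ(u) mod p` is a bijection onto `ℤ_p`. -/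
def PermutesMod (q p : ℕ) (φ : ZMod q → ZMod q) : Prop :=
  Function.Bijective (fun u : Fin p => (((φ ((u : ℕ) : ZMod q)).val : ℕ) : ZMod p))

/-- The function `f(x_1,…,x_m)` of Theorem 2 (two primes, `q = p₁p₂`, `m = m₁ + m₂`),
evaluated on the mixed-radix digit vector of `x`:
`f = (q/p₁)∑ f_i(x_{π(i)})f'_i(x_{π(i+1)}) + ∑ g_α(x_α)
   + (q/p₂)∑ h_j(x_{π'(m₁+j)})h'_j(x_{π'(m₁+j+1)}) + ∑ g'_β(x_{β+m₁})
   + γ·f₀(x_{π(m₁)})·h₀(x_{π'(m₁+1)})`,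
where `π` permutes the first block of `m₁` positions and `π'` the second block of
`m₂` positions (encoded as a permutation of the offsets within the block). -/
def f2 (p₁ p₂ m₁ m₂ : ℕ) (hm₁ : 2 ≤ m₁) (hm₂ : 2 ≤ m₂)
    (fi f'i : Fin (m₁ - 1) → ZMod (p₁ * p₂) → ZMod (p₁ * p₂))
    (hj h'j : Fin (m₂ - 1) → ZMod (p₁ * p₂) → ZMod (p₁ * p₂))
    (f₀ h₀ : ZMod (p₁ * p₂) → ZMod (p₁ * p₂))
    (g : Fin m₁ → ZMod (p₁ * p₂) → ZMod (p₁ * p₂))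
    (g' : Fin m₂ → ZMod (p₁ * p₂) → ZMod (p₁ * p₂))
    (γ : ZMod (p₁ * p₂)) (π : Equiv.Perm (Fin m₁)) (π' : Equiv.Perm (Fin m₂))
    (x : ℕ) : ZMod (p₁ * p₂) :=
  let D : ℕ → ZMod (p₁ * p₂) := fun j => mdigZ (p₁ * p₂) p₁ p₂ m₁ x j
  ((p₁ * p₂ / p₁ : ℕ) : ZMod (p₁ * p₂)) *
      (∑ i : Fin (m₁ - 1),
        fi i (D (π (Fin.castLE (by omega) i))) *
          f'i i (D (π (Fin.cast (by omega) i.succ)))) +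
    (∑ α : Fin m₁, g α (D α)) +
    ((p₁ * p₂ / p₂ : ℕ) : ZMod (p₁ * p₂)) *
      (∑ j : Fin (m₂ - 1),
        hj j (D (m₁ + π' (Fin.castLE (by omega) j))) *
          h'j j (D (m₁ + π' (Fin.cast (by omega) j.succ)))) +
    (∑ β : Fin m₂, g' β (D (m₁ + β))) +
    γ * f₀ (D (π ⟨m₁ - 1, by omega⟩)) * h₀ (D (m₁ + π' ⟨0, by omega⟩))

/-- The code `ψ(C_t)` of Theorem 2, for `t = p₁·t₂ + t₁` (`t₁ = t % p₁`,
`t₂ = t / p₁`): its sequences are indexed by `(d₁, d₂) ∈ {0,…,p₁−1}×{0,…,p₂−1}` and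
have `x`-th entry
`ξ_q^{f(x) + (q/p₁)(d₁x_{π(1)} + t₁x_{π(m₁)}) + (q/p₂)(d₂x_{π'(m₁+1)} + t₂x_{π'(m)})}`. -/
noncomputable def psi2 (p₁ p₂ m₁ m₂ : ℕ) (hm₁ : 2 ≤ m₁) (hm₂ : 2 ≤ m₂)
    (fi f'i : Fin (m₁ - 1) → ZMod (p₁ * p₂) → ZMod (p₁ * p₂))
    (hj h'j : Fin (m₂ - 1) → ZMod (p₁ * p₂) → ZMod (p₁ * p₂))
    (f₀ h₀ : ZMod (p₁ * p₂) → ZMod (p₁ * p₂))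
    (g : Fin m₁ → ZMod (p₁ * p₂) → ZMod (p₁ * p₂))
    (g' : Fin m₂ → ZMod (p₁ * p₂) → ZMod (p₁ * p₂))
    (γ : ZMod (p₁ * p₂)) (π : Equiv.Perm (Fin m₁)) (π' : Equiv.Perm (Fin m₂))
    (t : ℕ) : Fin p₁ × Fin p₂ → ℕ → ℂ :=
  fun d x =>
    let D : ℕ → ZMod (p₁ * p₂) := fun j => mdigZ (p₁ * p₂) p₁ p₂ m₁ x j
    xi (p₁ * p₂) ^
      (f2 p₁ p₂ m₁ m₂ hm₁ hm₂ fi f'i hj h'j f₀ h₀ g g' γ π π' x +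
          ((p₁ * p₂ / p₁ : ℕ) : ZMod (p₁ * p₂)) *
            (((d.1 : ℕ) : ZMod (p₁ * p₂)) * D (π ⟨0, by omega⟩) +
              ((t % p₁ : ℕ) : ZMod (p₁ * p₂)) * D (π ⟨m₁ - 1, by omega⟩)) +
          ((p₁ * p₂ / p₂ : ℕ) : ZMod (p₁ * p₂)) *
            (((d.2 : ℕ) : ZMod (p₁ * p₂)) * D (m₁ + π' ⟨0, by omega⟩) +
              ((t / p₁ : ℕ) : ZMod (p₁ * p₂)) * D (m₁ + π' ⟨m₂ - 1, by omega⟩))).val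

theorem xi_pow_val (q : ℕ) [NeZero q] (z : ZMod q) : xi q ^ z.val = ZMod.stdAddChar z := by
  conv_rhs => rw [← ZMod.natCast_zmod_val z]
  have h := ZMod.stdAddChar_coe (N := q) (z.val : ℤ)
  rw [Int.cast_natCast] at h
  rw [h, xi, ← Complex.exp_nat_mul]
  congr 1
  push_cast
  ring

theorem sum_range_mul_mod_div {R : Type*} [CommSemiring R] (a b : ℕ) (F G : ℕ → R) :
    ∑ x ∈ Finset.range (a * b), F (x % a) * G (x / a) =
      (∑ u ∈ Finset.range a, F u) * ∑ v ∈ Finset.range b, G v := by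
  induction b with
  | zero => simp
  | succ b ih =>
    rw [Nat.mul_succ, Finset.sum_range_add, ih, Finset.sum_range_succ, mul_add,
      Finset.sum_mul _ _ (G b)]
    congr 1
    refine Finset.sum_congr rfl fun u hu => ?_
    have hu := Finset.mem_range.mp hu
    rw [Nat.mul_add_mod, Nat.mod_eq_of_lt hu, Nat.mul_add_div (by omega), Nat.div_eq_of_lt hu,
      add_zero]

theorem sum_range_pow_digit {R : Type*} [CommSemiring R] {p m j : ℕ} (hj : j < m) (F : ℕ → R) :
    ∑ x ∈ Finset.range (p ^ m), F (x / p ^ j % p) =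
      (p : R) ^ (m - 1) * ∑ u ∈ Finset.range p, F u := by
  obtain ⟨k, rfl⟩ : ∃ k, m = j + (1 + k) := ⟨m - j - 1, by omega⟩
  have h₁ := sum_range_mul_mod_div (p ^ j) (p * p ^ k) (fun _ => (1 : R)) fun y => F (y % p)
  have h₂ := sum_range_mul_mod_div p (p ^ k) F fun _ => (1 : R)
  simp only [one_mul, mul_one, Finset.sum_const, Finset.card_range, nsmul_eq_mul] at h₁ h₂
  rw [pow_add, pow_add, pow_one, h₁, h₂, show j + (1 + k) - 1 = j + k by omega]
  push_cast
  ring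

theorem sum_stdAddChar_mul_sub {q p r : ℕ} [NeZero q] (hq : q = p * r) {s s' : ℕ} (hs : s < p)
    (hs' : s' < p) :
    ∑ u ∈ Finset.range p,
        (ZMod.stdAddChar ((r : ZMod q) * (((s : ZMod q) - (s' : ZMod q)) * (u : ZMod q))) : ℂ) =
      if s = s' then (p : ℂ) else 0 := by
  split_ifs with h
  · simp [h]
  · have hpow (u : ℕ) :
        (ZMod.stdAddChar ((r : ZMod q) * (((s : ZMod q) - (s' : ZMod q)) * (u : ZMod q))) : ℂ) =
        ZMod.stdAddChar ((r : ZMod q) * ((s : ZMod q) - (s' : ZMod q))) ^ u := by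
      rw [← AddChar.map_nsmul_eq_pow, nsmul_eq_mul]
      congr 1
      ring
    have hr : (r : ℤ) ≠ 0 := by
      intro hr
      exact NeZero.ne q (by rw [hq, Int.natCast_eq_zero.mp hr, mul_zero])
    have hne : (ZMod.stdAddChar ((r : ZMod q) * ((s : ZMod q) - (s' : ZMod q))) : ℂ) ≠ 1 := by
      rw [← AddChar.map_zero_eq_one (ZMod.stdAddChar (N := q)), ZMod.injective_stdAddChar.ne_iff]
      intro h0
      have h1 : (((r : ℤ) * ((s : ℤ) - s') : ℤ) : ZMod q) = 0 := by push_cast; exact h0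
      rw [ZMod.intCast_zmod_eq_zero_iff_dvd, hq, Nat.cast_mul, mul_comm (p : ℤ),
        mul_dvd_mul_iff_left hr] at h1
      have := Int.eq_zero_of_abs_lt_dvd h1 (abs_lt.mpr ⟨by omega, by omega⟩)
      omega
    have hone : (ZMod.stdAddChar ((r : ZMod q) * ((s : ZMod q) - (s' : ZMod q))) : ℂ) ^ p = 1 := by
      rw [← hpow]
      have h0 : (p : ZMod q) * r = 0 := by rw [← Nat.cast_mul, ← hq, ZMod.natCast_self]
      rw [show (r : ZMod q) * (((s : ZMod q) - (s' : ZMod q)) * p) = p * r * (s - s') by ring,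
        h0, zero_mul, AddChar.map_zero_eq_one]
    have hgeom := geom_sum_mul
      (ZMod.stdAddChar ((r : ZMod q) * ((s : ZMod q) - (s' : ZMod q))) : ℂ) p
    rw [hone, sub_self] at hgeom
    rw [Finset.sum_congr rfl fun u _ => hpow u]
    exact (mul_eq_zero.mp hgeom).resolve_right (sub_ne_zero.mpr hne)

/-- for the codes `ψ(C_t)` of Theorem 2 (arbitrary data), the
zero-shift correlation satisfies `Θ(ψ(C_t), ψ(C_{t'}))(0) = p₁^{m₁+1}·p₂^{m₂+1}`
if `t = t'` and `= 0` otherwise. -/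
theorem stmt_12 (p₁ p₂ m₁ m₂ : ℕ) (hp₁ : p₁.Prime) (hp₂ : p₂.Prime) (hlt : p₁ < p₂)
    (hm₁ : 2 ≤ m₁) (hm₂ : 2 ≤ m₂)
    (fi f'i : Fin (m₁ - 1) → ZMod (p₁ * p₂) → ZMod (p₁ * p₂))
    (hj h'j : Fin (m₂ - 1) → ZMod (p₁ * p₂) → ZMod (p₁ * p₂))
    (f₀ h₀ : ZMod (p₁ * p₂) → ZMod (p₁ * p₂))
    (g : Fin m₁ → ZMod (p₁ * p₂) → ZMod (p₁ * p₂))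
    (g' : Fin m₂ → ZMod (p₁ * p₂) → ZMod (p₁ * p₂))
    (γ : ZMod (p₁ * p₂)) (π : Equiv.Perm (Fin m₁)) (π' : Equiv.Perm (Fin m₂))
    (t t' : Fin (p₁ * p₂)) :
    codeACCF (p₁ ^ m₁ * p₂ ^ m₂)
        (psi2 p₁ p₂ m₁ m₂ hm₁ hm₂ fi f'i hj h'j f₀ h₀ g g' γ π π' t.val)
        (psi2 p₁ p₂ m₁ m₂ hm₁ hm₂ fi f'i hj h'j f₀ h₀ g g' γ π π' t'.val) 0 =
      if t = t' then (p₁ : ℂ) ^ (m₁ + 1) * (p₂ : ℂ) ^ (m₂ + 1) else 0 := by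
  have hq : NeZero (p₁ * p₂) := ⟨mul_ne_zero hp₁.ne_zero hp₂.ne_zero⟩
  have ha := (π ⟨m₁ - 1, by omega⟩).isLt
  have hb := (π' ⟨m₂ - 1, by omega⟩).isLt
  set a := (π ⟨m₁ - 1, by omega⟩ : ℕ) with ha_def
  set b := (π' ⟨m₂ - 1, by omega⟩ : ℕ) with hb_def
  let F : ℕ → ℂ := fun u => ZMod.stdAddChar ((p₂ : ZMod (p₁ * p₂)) *
    ((((t.val % p₁ : ℕ) : ZMod (p₁ * p₂)) - ((t'.val % p₁ : ℕ) : ZMod (p₁ * p₂))) *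
      (u : ZMod (p₁ * p₂))))
  let G : ℕ → ℂ := fun u => ZMod.stdAddChar ((p₁ : ZMod (p₁ * p₂)) *
    ((((t.val / p₁ : ℕ) : ZMod (p₁ * p₂)) - ((t'.val / p₁ : ℕ) : ZMod (p₁ * p₂))) *
      (u : ZMod (p₁ * p₂))))
  have hterm (d : Fin p₁ × Fin p₂) (x : ℕ) :
      psi2 p₁ p₂ m₁ m₂ hm₁ hm₂ fi f'i hj h'j f₀ h₀ g g' γ π π' t.val d x *
        (starRingEnd ℂ) (psi2 p₁ p₂ m₁ m₂ hm₁ hm₂ fi f'i hj h'j f₀ h₀ g g' γ π π' t'.val d x) =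
      F (x % p₁ ^ m₁ / p₁ ^ a % p₁) * G (x / p₁ ^ m₁ / p₂ ^ b % p₂) := by
    have hDa : mdigZ (p₁ * p₂) p₁ p₂ m₁ x a = ((x % p₁ ^ m₁ / p₁ ^ a % p₁ : ℕ) : ZMod _) := by
      rw [mdigZ, mdig, if_pos ha]
    have hDb : mdigZ (p₁ * p₂) p₁ p₂ m₁ x (m₁ + b) =
        ((x / p₁ ^ m₁ / p₂ ^ b % p₂ : ℕ) : ZMod _) := by
      rw [mdigZ, mdig, if_neg (by omega), Nat.add_sub_cancel_left]
    simp only [psi2, xi_pow_val, F, G]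
    rw [← AddChar.map_neg_eq_conj, ← AddChar.map_add_eq_mul, ← AddChar.map_add_eq_mul,
      Nat.mul_div_cancel_left _ hp₁.pos, Nat.mul_div_cancel _ hp₂.pos, ← ha_def, ← hb_def,
      hDa, hDb]
    congr 1
    ring
  have hF : ∑ u ∈ Finset.range p₁, F u = if t.val % p₁ = t'.val % p₁ then (p₁ : ℂ) else 0 :=
    sum_stdAddChar_mul_sub rfl (Nat.mod_lt _ hp₁.pos) (Nat.mod_lt _ hp₁.pos)
  have hG : ∑ u ∈ Finset.range p₂, G u = if t.val / p₁ = t'.val / p₁ then (p₂ : ℂ) else 0 :=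
    sum_stdAddChar_mul_sub (mul_comm _ _) (Nat.div_lt_of_lt_mul t.isLt)
      (Nat.div_lt_of_lt_mul t'.isLt)
  have htt : t = t' ↔ t.val % p₁ = t'.val % p₁ ∧ t.val / p₁ = t'.val / p₁ := by
    refine ⟨fun h => by simp [h], fun ⟨h₁, h₂⟩ => Fin.ext ?_⟩
    rw [← Nat.mod_add_div t.val p₁, h₁, h₂, Nat.mod_add_div]
  simp only [codeACCF, accf, le_refl, if_true, Int.toNat_zero, Nat.sub_zero, add_zero, hterm]
  rw [sum_range_mul_mod_div (p₁ ^ m₁) (p₂ ^ m₂) (fun y => F (y / p₁ ^ a % p₁))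
    (fun y => G (y / p₂ ^ b % p₂)), sum_range_pow_digit ha, sum_range_pow_digit hb, hF, hG,
    Finset.sum_const, Finset.card_univ, Fintype.card_prod, Fintype.card_fin, Fintype.card_fin,
    nsmul_eq_mul]
  obtain ⟨k, rfl⟩ : ∃ k, m₁ = k + 1 := ⟨m₁ - 1, by omega⟩
  obtain ⟨l, rfl⟩ : ∃ l, m₂ = l + 1 := ⟨m₂ - 1, by omega⟩
  by_cases h₁ : t.val % p₁ = t'.val % p₁ <;> by_cases h₂ : t.val / p₁ = t'.val / p₁ <;>
    simp only [htt, h₁, h₂, and_self, and_true, and_false, if_true, if_false,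
      mul_zero, zero_mul]
  push_cast
  ring
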